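/- arXiv:1908.07375 — 2 statements merged into one kernel-verified Lean document; each statement's English description precedes it below -/
import Mathlib

section
/- Let d ≥ 1, let ℓ : [0,∞) → [0,∞) be nonincreasing, let n ≥ 1 and a ≥ n be real numbers, let k ≥ 1 be an integer, let z ∈ kℤ^d, and let y ∈ ℤ^d satisfy ‖y − z‖_∞ < k/2 (i.e., y lies in the open cube of side k centered at z). Then ℓ_{ka}(|nz − x|) ≥ ℓ_a(|ny − x|) for every x ∈ ℝ^d; consequently, for every countable family (X_j)_{j∈J} of points of ℝ^d, Σ_{j∈J} ℓ_{ka}(|nz − X_j|) ≥ Σ_{j∈J} ℓ_a(|ny − X_j|) in [0,∞]. -/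
open scoped ENNReal

/-- The shifted path-loss function `ℓ_a`. -/
noncomputable def shiftedPathLoss (d : ℕ) (ℓ : ℝ → ℝ) (a r : ℝ) : ℝ :=
  if r < a * Real.sqrt d / 2 then ℓ 0 else ℓ (r - a * Real.sqrt d / 2)

theorem stmt1 (d : ℕ) (hd : 1 ≤ d) (ℓ : ℝ → ℝ)
    (hℓ_nonneg : ∀ r, 0 ≤ r → 0 ≤ ℓ r)
    (hℓ_anti : AntitoneOn ℓ (Set.Ici 0))
    (n a : ℝ) (hn : 1 ≤ n) (ha : n ≤ a)
    (k : ℕ) (hk : 1 ≤ k)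
    (z y : EuclideanSpace ℝ (Fin d))
    (hz : ∀ j, ∃ m : ℤ, z j = (k : ℝ) * m)   -- z ∈ kℤ^d
    (hy : ∀ j, ∃ m : ℤ, y j = (m : ℝ))        -- y ∈ ℤ^d
    (hyz : ∀ j, |y j - z j| < (k : ℝ) / 2) :   -- ‖y − z‖_∞ < k/2
    (∀ x : EuclideanSpace ℝ (Fin d),
        shiftedPathLoss d ℓ a ‖n • y - x‖ ≤ shiftedPathLoss d ℓ ((k : ℝ) * a) ‖n • z - x‖) ∧
    ∀ (J : Type*) (_ : Countable J) (X : J → EuclideanSpace ℝ (Fin d)),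
      ∑' j, ENNReal.ofReal (shiftedPathLoss d ℓ a ‖n • y - X j‖) ≤
        ∑' j, ENNReal.ofReal (shiftedPathLoss d ℓ ((k : ℝ) * a) ‖n • z - X j‖) := by
  have key : ∀ x : EuclideanSpace ℝ (Fin d),
      shiftedPathLoss d ℓ a ‖n • y - x‖ ≤ shiftedPathLoss d ℓ ((k : ℝ) * a) ‖n • z - x‖ := by
    intro x
    have hform : ∀ c r : ℝ, shiftedPathLoss d ℓ c r = ℓ (max 0 (r - c * Real.sqrt d / 2)) := by
      intro c r
      unfold shiftedPathLoss
      split_ifs with h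
      · rw [max_eq_left (by linarith)]
      · rw [max_eq_right (by linarith)]
    have hk1 : (1 : ℝ) ≤ k := by exact_mod_cast hk
    have hcoord : ∀ j, |y j - z j| ≤ ((k : ℝ) - 1) / 2 := by
      intro j
      obtain ⟨m, hm⟩ := hz j
      obtain ⟨p, hp⟩ := hy j
      have h := hyz j
      rw [hm, hp] at h ⊢
      rw [abs_lt] at h
      obtain ⟨h1, h2⟩ := h
      have h1' : -(k : ℤ) < 2 * (p - k * m) := by
        have : (-(k : ℝ)) < 2 * (p - k * m) := by linarith
        exact_mod_cast this
      have h2' : 2 * (p - k * m) < (k : ℤ) := by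
        have : 2 * (p - k * m) < (k : ℝ) := by linarith
        exact_mod_cast this
      have h1'' : -(k : ℤ) + 1 ≤ 2 * (p - k * m) := h1'
      have h2'' : 2 * (p - k * m) + 1 ≤ (k : ℤ) := h2'
      have e1 : -(k : ℝ) + 1 ≤ 2 * (p - k * m) := by exact_mod_cast h1''
      have e2 : 2 * (p - k * m) + 1 ≤ (k : ℝ) := by exact_mod_cast h2''
      rw [abs_le]
      constructor <;> linarith
    have hnorm : ‖z - y‖ ≤ Real.sqrt d * (((k : ℝ) - 1) / 2) := by
      rw [EuclideanSpace.norm_eq]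
      apply Real.sqrt_le_iff.mpr
      refine ⟨by have := Real.sqrt_nonneg (d : ℝ); apply mul_nonneg this; linarith, ?_⟩
      rw [mul_pow, Real.sq_sqrt (Nat.cast_nonneg d)]
      calc ∑ i, ‖(z - y) i‖ ^ 2 ≤ ∑ _i : Fin d, (((k : ℝ) - 1) / 2) ^ 2 := by
            apply Finset.sum_le_sum
            intro i _
            apply pow_le_pow_left₀ (norm_nonneg _)
            have := hcoord i
            rw [abs_sub_comm] at this
            simpa [Real.norm_eq_abs] using this
        _ = _ := by simp
    have htri : ‖n • z - x‖ ≤ ‖n • y - x‖ + n * ‖z - y‖ := by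
      have e : n • z - x = (n • y - x) + n • (z - y) := by rw [smul_sub]; abel
      rw [e]
      refine (norm_add_le _ _).trans ?_
      rw [norm_smul, Real.norm_eq_abs, abs_of_nonneg (by linarith)]
    have hb : n * ‖z - y‖ ≤ a * (Real.sqrt d * (((k : ℝ) - 1) / 2)) :=
      mul_le_mul ha hnorm (norm_nonneg _) (by linarith)
    rw [hform, hform]
    apply hℓ_anti (Set.mem_Ici.mpr (le_max_left _ _)) (Set.mem_Ici.mpr (le_max_left _ _))
    apply max_le_max le_rfl
    linarith
  exact ⟨key, fun J _ X => ENNReal.tsum_le_tsum fun j => ENNReal.ofReal_le_ofReal (key (X j))⟩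
end

section
/- Let (Ω, F, ℙ) be a probability space, let N ≥ 1, and let A₁, …, A_N and B₁, …, B_N be random variables taking values in {0,1} such that the σ-algebra generated by (A₁, …, A_N) is independent of the σ-algebra generated by (B₁, …, B_N). Suppose q_A, q_B ≥ 0 are such that for every subset S ⊆ {1, …, N}, E[∏_{i∈S} (1 − A_i)] ≤ q_A^{|S|} and E[∏_{i∈S} (1 − B_i)] ≤ q_B^{|S|}. Then ℙ(A₁·B₁ = 0, …, A_N·B_N = 0) ≤ (√q_A + √q_B)^N. -/
open MeasureTheory

theorem stmt11 {Ω : Type*} [MeasurableSpace Ω] (ℙ : Measure Ω) [IsProbabilityMeasure ℙ]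
    (N : ℕ) (hN : 1 ≤ N) (A B : Fin N → Ω → ℝ)
    (hAmeas : ∀ i, Measurable (A i)) (hBmeas : ∀ i, Measurable (B i))
    (hA01 : ∀ i ω, A i ω = 0 ∨ A i ω = 1)
    (hB01 : ∀ i ω, B i ω = 0 ∨ B i ω = 1)
    (hIndep : ProbabilityTheory.Indep
      (⨆ i, MeasurableSpace.comap (A i) Real.measurableSpace)
      (⨆ i, MeasurableSpace.comap (B i) Real.measurableSpace) ℙ)
    (qA qB : ℝ) (hqA0 : 0 ≤ qA) (hqB0 : 0 ≤ qB)
    (hqA : ∀ S : Finset (Fin N), ∫ ω, ∏ i ∈ S, (1 - A i ω) ∂ℙ ≤ qA ^ S.card)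
    (hqB : ∀ S : Finset (Fin N), ∫ ω, ∏ i ∈ S, (1 - B i ω) ∂ℙ ≤ qB ^ S.card) :
    ℙ {ω | ∀ i, A i ω * B i ω = 0} ≤
      ENNReal.ofReal ((Real.sqrt qA + Real.sqrt qB) ^ N) := by
  classical
  have hsA : 0 ≤ Real.sqrt qA := Real.sqrt_nonneg _
  have hsB : 0 ≤ Real.sqrt qB := Real.sqrt_nonneg _
  have triv : 1 ≤ Real.sqrt qA + Real.sqrt qB → ℙ {ω | ∀ i, A i ω * B i ω = 0} ≤
      ENNReal.ofReal ((Real.sqrt qA + Real.sqrt qB) ^ N) := by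
    intro h
    refine prob_le_one.trans ?_
    rw [ENNReal.one_le_ofReal]
    exact one_le_pow₀ h
  by_cases hB1 : 1 ≤ qB
  · apply triv
    have := Real.one_le_sqrt.mpr hB1
    linarith
  by_cases hA1 : 1 ≤ qA
  · apply triv
    have := Real.one_le_sqrt.mpr hA1
    linarith
  push Not at hA1 hB1
  have hleA : qA ≤ Real.sqrt qA := by
    apply Real.le_sqrt_of_sq_le
    nlinarith
  have hleB : qB ≤ Real.sqrt qB := by
    apply Real.le_sqrt_of_sq_le
    nlinarith
  have hA0 : ∀ i ω, 0 ≤ A i ω ∧ A i ω ≤ 1 := fun i ω => by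
    rcases hA01 i ω with h | h <;> rw [h] <;> norm_num
  have hB0 : ∀ i ω, 0 ≤ B i ω ∧ B i ω ≤ 1 := fun i ω => by
    rcases hB01 i ω with h | h <;> rw [h] <;> norm_num
  have bint : ∀ F : Ω → ℝ, Measurable F → (∀ ω, 0 ≤ F ω ∧ F ω ≤ 1) → Integrable F ℙ := by
    intro F hF h
    refine Integrable.of_bound hF.aestronglyMeasurable 1 (Filter.Eventually.of_forall fun ω => ?_)
    rw [Real.norm_eq_abs, abs_of_nonneg (h ω).1]
    exact (h ω).2
  have hAm : ∀ i, Measurable[⨆ i, MeasurableSpace.comap (A i) Real.measurableSpace] (A i) := fun i =>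
    (comap_measurable (A i)).mono (le_iSup (fun i => MeasurableSpace.comap (A i) Real.measurableSpace) i) le_rfl
  have hBm : ∀ i, Measurable[⨆ i, MeasurableSpace.comap (B i) Real.measurableSpace] (B i) := fun i =>
    (comap_measurable (B i)).mono (le_iSup (fun i => MeasurableSpace.comap (B i) Real.measurableSpace) i) le_rfl
  -- F T = prod over T of failures, times prod over complement of A
  let F : Finset (Fin N) → Ω → ℝ := fun T ω => (∏ i ∈ T, (1 - A i ω)) * ∏ i ∈ Finset.univ \ T, A i ω
  let G : Finset (Fin N) → Ω → ℝ := fun T ω => ∏ i ∈ T, (1 - B i ω)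
  have hF1 : ∀ T, Measurable[⨆ i, MeasurableSpace.comap (A i) Real.measurableSpace] (F T) := fun T =>
    (Finset.measurable_prod T fun i _ => measurable_const.sub (hAm i)).mul
      (Finset.measurable_prod _ fun i _ => hAm i)
  have hG1 : ∀ T, Measurable[⨆ i, MeasurableSpace.comap (B i) Real.measurableSpace] (G T) := fun T =>
    Finset.measurable_prod T fun i _ => measurable_const.sub (hBm i)
  have hF2 : ∀ T, Measurable (F T) := fun T =>
    (Finset.measurable_prod T fun i _ => measurable_const.sub (hAmeas i)).mul
      (Finset.measurable_prod _ fun i _ => hAmeas i)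
  have hG2 : ∀ T, Measurable (G T) := fun T =>
    Finset.measurable_prod T fun i _ => measurable_const.sub (hBmeas i)
  have hF01 : ∀ T ω, 0 ≤ F T ω ∧ F T ω ≤ 1 := fun T ω => by
    have h1 : 0 ≤ ∏ i ∈ T, (1 - A i ω) := Finset.prod_nonneg fun i _ => by linarith [(hA0 i ω).2]
    have h2 : ∏ i ∈ T, (1 - A i ω) ≤ 1 := Finset.prod_le_one
      (fun i _ => by linarith [(hA0 i ω).2]) (fun i _ => by linarith [(hA0 i ω).1])
    have h3 : 0 ≤ ∏ i ∈ Finset.univ \ T, A i ω := Finset.prod_nonneg fun i _ => (hA0 i ω).1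
    have h4 : ∏ i ∈ Finset.univ \ T, A i ω ≤ 1 := Finset.prod_le_one
      (fun i _ => (hA0 i ω).1) (fun i _ => (hA0 i ω).2)
    exact ⟨mul_nonneg h1 h3, mul_le_one₀ h2 h3 h4⟩
  have hG01 : ∀ T ω, 0 ≤ G T ω ∧ G T ω ≤ 1 := fun T ω =>
    ⟨Finset.prod_nonneg fun i _ => by linarith [(hB0 i ω).2],
     Finset.prod_le_one
      (fun i _ => by linarith [(hB0 i ω).2]) (fun i _ => by linarith [(hB0 i ω).1])⟩
  have hind : ∀ T S, ∫ ω, F T ω * G S ω ∂ℙ = (∫ ω, F T ω ∂ℙ) * ∫ ω, G S ω ∂ℙ := by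
    intro T S
    have : ProbabilityTheory.IndepFun (F T) (G S) ℙ := by
      rw [ProbabilityTheory.IndepFun_iff_Indep]
      exact ProbabilityTheory.indep_of_indep_of_le_right
        (ProbabilityTheory.indep_of_indep_of_le_left hIndep (hF1 T).comap_le) (hG1 S).comap_le
    exact this.integral_fun_mul_eq_mul_integral (hF2 T).aestronglyMeasurable
      (hG2 S).aestronglyMeasurable
  have e1 : ∀ ω, ∏ i, (1 - A i ω * B i ω)
      = ∑ T ∈ (Finset.univ : Finset (Fin N)).powerset, F T ω * G (Finset.univ \ T) ω := by
    intro ω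
    have : ∀ i, 1 - A i ω * B i ω = (1 - A i ω) + A i ω * (1 - B i ω) := fun i => by ring
    simp_rw [this]
    rw [Finset.prod_add]
    refine Finset.sum_congr rfl fun T _ => ?_
    simp only [F, G, Finset.prod_mul_distrib]
    ring
  have e2 : ∀ ω, ∑ T ∈ (Finset.univ : Finset (Fin N)).powerset,
      F T ω * qB ^ (Finset.univ \ T).card
      = ∑ T ∈ (Finset.univ : Finset (Fin N)).powerset,
        ((1 - qB) ^ T.card * qB ^ (Finset.univ \ T).card) * ∏ i ∈ T, (1 - A i ω) := by
    intro ω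
    have l : ∏ i, ((1 - A i ω) + A i ω * qB) = ∏ i, ((1 - qB) * (1 - A i ω) + qB) :=
      Finset.prod_congr rfl fun i _ => by ring
    rw [Finset.prod_add, Finset.prod_add] at l
    simp only [Finset.prod_mul_distrib, Finset.prod_const] at l
    refine Eq.trans ?_ (l.trans ?_)
    · exact Finset.sum_congr rfl fun T _ => by simp only [F]; ring
    · exact Finset.sum_congr rfl fun T _ => by ring
  have hset : {ω | ∀ i, A i ω * B i ω = 0} = ⋂ i, {ω | A i ω * B i ω = 0} := by
    ext; simp
  have hmeas : MeasurableSet {ω | ∀ i, A i ω * B i ω = 0} := by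
    rw [hset]
    exact MeasurableSet.iInter fun i =>
      ((hAmeas i).mul (hBmeas i)) (measurableSet_singleton 0)
  have key : ℙ.real {ω | ∀ i, A i ω * B i ω = 0} ≤ (Real.sqrt qA + Real.sqrt qB) ^ N := by
    calc ℙ.real {ω | ∀ i, A i ω * B i ω = 0}
        = ∫ ω, ∏ i, (1 - A i ω * B i ω) ∂ℙ := by
          rw [← integral_indicator_one hmeas]
          congr 1
          ext ω
          by_cases h : ∀ i, A i ω * B i ω = 0
          · rw [Set.indicator_of_mem (by exact h)]
            simp [h]
          · rw [Set.indicator_of_notMem (by exact h)]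
            push Not at h
            obtain ⟨i, hi⟩ := h
            symm
            apply Finset.prod_eq_zero (Finset.mem_univ i)
            rcases hA01 i ω with h | h <;> rcases hB01 i ω with h' | h' <;> simp_all
      _ = ∑ T ∈ (Finset.univ : Finset (Fin N)).powerset,
            (∫ ω, F T ω ∂ℙ) * ∫ ω, G (Finset.univ \ T) ω ∂ℙ := by
          simp_rw [e1]
          rw [integral_finsetSum]
          · simp_rw [hind]
          · intro T _
            exact bint _ ((hF2 T).mul (hG2 _)) fun ω =>
              ⟨mul_nonneg (hF01 T ω).1 (hG01 _ ω).1,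
               mul_le_one₀ (hF01 T ω).2 (hG01 _ ω).1 (hG01 _ ω).2⟩
      _ ≤ ∑ T ∈ (Finset.univ : Finset (Fin N)).powerset,
            (∫ ω, F T ω ∂ℙ) * qB ^ (Finset.univ \ T).card := by
          refine Finset.sum_le_sum fun T _ => ?_
          exact mul_le_mul_of_nonneg_left (hqB _) (integral_nonneg fun ω => (hF01 T ω).1)
      _ = ∫ ω, ∑ T ∈ (Finset.univ : Finset (Fin N)).powerset,
            F T ω * qB ^ (Finset.univ \ T).card ∂ℙ := by
          rw [integral_finsetSum]
          · simp_rw [integral_mul_const]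
          · intro T _
            exact (bint _ (hF2 T) (hF01 T)).mul_const _
      _ = ∑ T ∈ (Finset.univ : Finset (Fin N)).powerset,
            ((1 - qB) ^ T.card * qB ^ (Finset.univ \ T).card) * ∫ ω, ∏ i ∈ T, (1 - A i ω) ∂ℙ := by
          simp_rw [e2]
          rw [integral_finsetSum]
          · simp_rw [integral_const_mul]
          · intro T _
            refine (bint (fun ω => ∏ i ∈ T, (1 - A i ω)) (Finset.measurable_prod T fun i _ => measurable_const.sub (hAmeas i))
              fun ω => ?_).const_mul _
            exact ⟨Finset.prod_nonneg fun i _ => by linarith [(hA0 i ω).2],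
              Finset.prod_le_one
                (fun i _ => by linarith [(hA0 i ω).2]) (fun i _ => by linarith [(hA0 i ω).1])⟩
      _ ≤ ∑ T ∈ (Finset.univ : Finset (Fin N)).powerset,
            ((1 - qB) ^ T.card * qB ^ (Finset.univ \ T).card) * qA ^ T.card := by
          refine Finset.sum_le_sum fun T _ => ?_
          refine mul_le_mul_of_nonneg_left (hqA _) ?_
          have : 0 ≤ 1 - qB := by linarith
          positivity
      _ = ((1 - qB) * qA + qB) ^ N := by
          have l : ∏ _i : Fin N, ((1 - qB) * qA + qB) = ((1 - qB) * qA + qB) ^ N := by simp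
          rw [← l, Finset.prod_add]
          simp only [Finset.prod_const]
          exact Finset.sum_congr rfl fun T _ => by rw [mul_pow]; ring
      _ ≤ (Real.sqrt qA + Real.sqrt qB) ^ N := by
          apply pow_le_pow_left₀
          · nlinarith
          · nlinarith
  rw [← ofReal_measureReal]
  exact ENNReal.ofReal_le_ofReal key
end
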